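/- (Theorem 2.) Fix integers p ≥ 1, q, and k ≥ 0, and let g = R(2π/p, 2πq/p). A function f : ℝ⁴ → ℝ that is the evaluation of a homogeneous harmonic polynomial of degree k satisfies f ∘ g = f if and only if f is a real linear combination of the following functions, where ℓ and m range over positive integers and every function F_{k,ℓ,m} appearing is subject to |ℓ| + |m| ≤ k and ℓ + m ≡ k (mod 2): F_{k,0,0}; F_{k,ℓ,0} and F_{k,−ℓ,0} for ℓ ≡ 0 (mod p); F_{k,0,m} and F_{k,0,−m} for qm ≡ 0 (mod p); F_{k,ℓ,m} + F_{k,−ℓ,−m} and F_{k,−ℓ,m} − F_{k,ℓ,−m} for ℓ ≡ qm (mod p); F_{k,ℓ,m} − F_{k,−ℓ,−m} and F_{k,−ℓ,m} + F_{k,ℓ,−m} for ℓ ≡ −qm (mod p). -/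

import Mathlib

noncomputable section


/-- `circ j u v` is `A_j(u,v)`: the real part of `(u + iv)^|j|` if `j ≥ 0`,
and the imaginary part if `j < 0`. -/
def circ (j : ℤ) (u v : ℝ) : ℝ :=
  if 0 ≤ j then (((u : ℂ) + v * Complex.I) ^ j.natAbs).re
  else (((u : ℂ) + v * Complex.I) ^ j.natAbs).im

/-- `dd k ℓ m = (k - |ℓ| - |m|) / 2`. -/
def dd (k : ℕ) (ℓ m : ℤ) : ℕ := (k - ℓ.natAbs - m.natAbs) / 2

/-- The function `F_{kℓm} : ℝ⁴ → ℝ`. -/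
def F (k : ℕ) (ℓ m : ℤ) (p : Fin 4 → ℝ) : ℝ :=
  (∑ i ∈ Finset.range (dd k ℓ m + 1),
      (Nat.choose (m.natAbs + dd k ℓ m) i : ℝ) *
      (Nat.choose (ℓ.natAbs + dd k ℓ m) (dd k ℓ m - i) : ℝ) *
      (p 0 ^ 2 + p 1 ^ 2) ^ i * (-(p 2 ^ 2 + p 3 ^ 2)) ^ (dd k ℓ m - i))
    * circ ℓ (p 0) (p 1) * circ m (p 2) (p 3)

/-- `f` is the evaluation of a homogeneous polynomial of degree `k`. -/
def IsHomogeneousPolyEval (k : ℕ) (f : (Fin 4 → ℝ) → ℝ) : Prop :=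
  ∃ P : MvPolynomial (Fin 4) ℝ, P.IsHomogeneous k ∧ ∀ v, MvPolynomial.eval v P = f v

/-- `f` is harmonic: the sum of its four second coordinate partial derivatives vanishes. -/
def IsHarmonic (f : (Fin 4 → ℝ) → ℝ) : Prop :=
  ∀ v : Fin 4 → ℝ,
    ∑ i : Fin 4, fderiv ℝ (fun w => fderiv ℝ f w (Pi.single i 1)) v (Pi.single i 1) = 0

/-- The Jacobi polynomial `P_d^{(a,b)}`. -/
def jacobiP (d a b : ℕ) (u : ℝ) : ℝ :=
  (1 / 2 ^ d) * ∑ i ∈ Finset.range (d + 1),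
    (Nat.choose (a + d) i : ℝ) * (Nat.choose (b + d) (d - i) : ℝ) *
      (u + 1) ^ i * (u - 1) ^ (d - i)

/-- The radial function `X_{kℓm}`. -/
def Xrad (k : ℕ) (ℓ m : ℤ) (χ : ℝ) : ℝ :=
  Real.cos χ ^ ℓ.natAbs * Real.sin χ ^ m.natAbs *
    jacobiP (dd k ℓ m) m.natAbs ℓ.natAbs (Real.cos (2 * χ))

/-- The circular harmonic: `cos(|j|·θ)` if `j ≥ 0`, else `sin(|j|·θ)`. -/
def circHarm (j : ℤ) (θ : ℝ) : ℝ :=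
  if 0 ≤ j then Real.cos (j.natAbs * θ) else Real.sin (j.natAbs * θ)

/-- The eigenmode `Ψ̃_{kℓm}` in toroidal coordinates. -/
def PsiT (k : ℕ) (ℓ m : ℤ) (χ θ φ : ℝ) : ℝ :=
  Xrad k ℓ m χ * circHarm ℓ θ * circHarm m φ

/-- The rotation `R(Δθ, Δφ)` of `ℝ⁴`. -/
def Rrot (a b : ℝ) (p : Fin 4 → ℝ) : Fin 4 → ℝ :=
  ![p 0 * Real.cos a - p 1 * Real.sin a,
    p 0 * Real.sin a + p 1 * Real.cos a,
    p 2 * Real.cos b - p 3 * Real.sin b,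
    p 2 * Real.sin b + p 3 * Real.cos b]

/-- The isometry `A(x,y,z,w) = (z, -w, -x, y)`. -/
def Amap (p : Fin 4 → ℝ) : Fin 4 → ℝ :=
  ![p 2, -(p 3), -(p 0), p 1]

/-- The sign `σ_{kℓm}`. -/
def sgn (k : ℕ) (ℓ m : ℤ) : ℝ :=
  (if Even (dd k ℓ m) then 1 else -1) * (if 0 ≤ ℓ then 1 else -1) *
  (if 0 ≤ m then 1 else -1) * (if Even m then 1 else -1)

lemma MvPolynomial.pderiv_pderiv_comm {σ R : Type*} [CommSemiring R] (i j : σ)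
    (P : MvPolynomial σ R) : pderiv i (pderiv j P) = pderiv j (pderiv i P) := by
  classical
  ext s
  by_cases h : i = j
  · rw [h]
  · simp [coeff_pderiv, h, Ne.symm h, add_right_comm, mul_right_comm]

/-- The chain rule for partial derivatives of a polynomial under a substitution. -/
lemma MvPolynomial.pderiv_aeval_eq_sum {σ τ R S : Type*} [Fintype σ] [CommSemiring R]
    [CommSemiring S] [Algebra R S] (g : σ → MvPolynomial τ S) (j : τ) (P : MvPolynomial σ R) :
    pderiv j (aeval g P) = ∑ i, aeval g (pderiv i P) * pderiv j (g i) := by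
  classical
  induction P using MvPolynomial.induction_on with
  | C a =>
    simp [MvPolynomial.algebraMap_eq, IsScalarTower.algebraMap_apply R S (MvPolynomial τ S)]
  | add p q hp hq => simp only [map_add, hp, hq, add_mul, Finset.sum_add_distrib]
  | mul_X p n hp =>
    simp only [map_mul, Derivation.leibniz, smul_eq_mul, hp, aeval_X, map_add, add_mul,
      Finset.sum_add_distrib, pderiv_X, Pi.single_apply, mul_ite]
    simp [Finset.mul_sum, mul_assoc, apply_ite (aeval g), ite_mul]

/-- The Fréchet derivative of a polynomial function along a coordinate direction. -/
lemma MvPolynomial.fderiv_eval_single {ι : Type*} [Fintype ι] [DecidableEq ι]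
    (P : MvPolynomial ι ℝ) (v : ι → ℝ) (i : ι) :
    fderiv ℝ (fun w => eval w P) v (Pi.single i 1) = eval v (pderiv i P) := by
  have hd (Q : MvPolynomial ι ℝ) : DifferentiableAt ℝ (fun w => eval w Q) v :=
    (AnalyticOnNhd.eval_mvPolynomial Q v (Set.mem_univ v)).differentiableAt
  induction P using MvPolynomial.induction_on with
  | C a => simp
  | add p q hp hq =>
    simp only [map_add]
    rw [fderiv_fun_add (hd p) (hd q), add_apply, hp, hq]
  | mul_X p n hp =>
    simp only [map_mul, eval_X, Derivation.leibniz, smul_eq_mul, map_add, pderiv_X]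
    rw [fderiv_fun_mul (hd p) (differentiableAt_apply n v)]
    simp [hp, fderiv_apply, Pi.single_apply, eq_comm, apply_ite (eval v)]

/-- Substitution expressing the coordinates `x, y, z, w` through formal conjugate pairs
`x ± iy`, `z ± iw`. -/
def conjCoords : Fin 4 → MvPolynomial (Fin 4) ℂ :=
  ![.C (1 / 2) * (.X 0 + .X 1), .C (-Complex.I / 2) * (.X 0 - .X 1),
    .C (1 / 2) * (.X 2 + .X 3), .C (-Complex.I / 2) * (.X 2 - .X 3)]

/-- The point `(x + iy, x - iy, z + iw, z - iw)`. -/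
def conjPoint (v : Fin 4 → ℝ) : Fin 4 → ℂ :=
  ![v 0 + v 1 * Complex.I, v 0 - v 1 * Complex.I, v 2 + v 3 * Complex.I, v 2 - v 3 * Complex.I]

lemma isHomogeneous_aeval_conjCoords {k : ℕ} {P : MvPolynomial (Fin 4) ℝ}
    (hP : P.IsHomogeneous k) : (MvPolynomial.aeval conjCoords P).IsHomogeneous k := by
  have h := hP.aeval (S := ℂ) conjCoords (n := 1) (fun i => by
    have hX (j : Fin 4) := MvPolynomial.isHomogeneous_X ℂ j
    fin_cases i
    · exact ((hX 0).add (hX 1)).C_mul _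
    · exact ((hX 0).sub (hX 1)).C_mul _
    · exact ((hX 2).add (hX 3)).C_mul _
    · exact ((hX 2).sub (hX 3)).C_mul _)
  rwa [one_mul] at h

lemma eval_conjPoint_aeval (P : MvPolynomial (Fin 4) ℝ) (v : Fin 4 → ℝ) :
    MvPolynomial.eval (conjPoint v) (MvPolynomial.aeval conjCoords P)
      = ((MvPolynomial.eval v P : ℝ) : ℂ) := by
  have hc (i : Fin 4) : MvPolynomial.eval (conjPoint v) (conjCoords i) = v i := by
    fin_cases i <;> simp [conjCoords, conjPoint] <;> ring_nf <;> simp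
  induction P using MvPolynomial.induction_on with
  | C a => simp [IsScalarTower.algebraMap_apply ℝ ℂ (MvPolynomial (Fin 4) ℂ),
      MvPolynomial.algebraMap_eq]
  | add p q hp hq => simp [hp, hq]
  | mul_X p n hp => simp [hp, hc]

lemma pderiv_aeval_conjCoords {P : MvPolynomial (Fin 4) ℝ}
    (hP : ∑ i, MvPolynomial.pderiv i (MvPolynomial.pderiv i P) = 0) :
    MvPolynomial.pderiv 0 (MvPolynomial.pderiv 1 (MvPolynomial.aeval conjCoords P))
      + MvPolynomial.pderiv 2 (MvPolynomial.pderiv 3 (MvPolynomial.aeval conjCoords P)) = 0 := by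
  have h := congrArg (fun R => MvPolynomial.C (1 / 4) * MvPolynomial.aeval conjCoords R) hP
  have h2 : (MvPolynomial.C 2⁻¹ : MvPolynomial (Fin 4) ℂ) ^ 2 = MvPolynomial.C 4⁻¹ := by
    rw [← map_pow]; norm_num
  have hI : (MvPolynomial.C (-Complex.I / 2) : MvPolynomial (Fin 4) ℂ) ^ 2
      = - MvPolynomial.C 4⁻¹ := by
    rw [← map_pow, ← map_neg, div_pow, neg_sq, Complex.I_sq]; norm_num
  simp only [Fin.sum_univ_four, map_add, map_zero, mul_zero] at h
  rw [← h]
  simp only [MvPolynomial.pderiv_aeval_eq_sum, Fin.sum_univ_four, map_add, Derivation.leibniz]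
  rw [MvPolynomial.pderiv_pderiv_comm 1 0, MvPolynomial.pderiv_pderiv_comm 3 2]
  generalize MvPolynomial.aeval conjCoords (MvPolynomial.pderiv 0 (MvPolynomial.pderiv 0 P)) = a
  generalize MvPolynomial.aeval conjCoords (MvPolynomial.pderiv 1 (MvPolynomial.pderiv 1 P)) = b
  generalize MvPolynomial.aeval conjCoords (MvPolynomial.pderiv 2 (MvPolynomial.pderiv 2 P)) = c
  generalize MvPolynomial.aeval conjCoords (MvPolynomial.pderiv 3 (MvPolynomial.pderiv 3 P)) = d
  simp only [conjCoords, Fin.isValue, one_div, Matrix.cons_val_zero, Matrix.cons_val_one,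
    Matrix.cons_val, Derivation.leibniz, map_add, map_sub, MvPolynomial.pderiv_X,
    MvPolynomial.pderiv_C, smul_eq_mul, Pi.single_apply, Fin.reduceEq, if_true, if_false]
  simp
  linear_combination (a + c) * h2 - (b + d) * hI

lemma laplacian_eq_zero_of_isHarmonic {P : MvPolynomial (Fin 4) ℝ} {f : (Fin 4 → ℝ) → ℝ}
    (hP : ∀ v, MvPolynomial.eval v P = f v) (hf : IsHarmonic f) :
    ∑ i, MvPolynomial.pderiv i (MvPolynomial.pderiv i P) = 0 := by
  obtain rfl : (fun v => MvPolynomial.eval v P) = f := funext hP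
  refine MvPolynomial.funext fun v => ?_
  have h := hf v
  simp only [MvPolynomial.fderiv_eval_single] at h
  simpa using h

/-- A solution of the harmonicity recurrence is a multiple of the product of binomials. -/
lemma exists_eq_mul_choose (L M d : ℕ) (c : ℕ → ℂ)
    (hc : ∀ i j, i + j + 1 = d →
      c (i + 1) * ((L + i + 1) * (i + 1)) + c i * ((M + j + 1) * (j + 1)) = 0) :
    ∃ a : ℂ, ∀ i ≤ d,
      c i = a * ((M + d).choose i * (L + d).choose (d - i) * (-1) ^ (d - i)) := by
  have hne : ((L + d).choose d : ℂ) ≠ 0 := by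
    exact_mod_cast (Nat.choose_pos (by omega)).ne'
  refine ⟨c 0 / ((L + d).choose d * (-1) ^ d), fun i hi => ?_⟩
  induction i with
  | zero => simp; field_simp
  | succ i ih =>
    obtain ⟨j, rfl⟩ : ∃ j, d = i + j + 1 := ⟨d - i - 1, by omega⟩
    have h1 : (((M + (i + j + 1)).choose (i + 1) : ℕ) : ℂ) * (i + 1)
        = (M + (i + j + 1)).choose i * (M + j + 1) := by
      have := Nat.choose_succ_right_eq (M + (i + j + 1)) i
      rw [show M + (i + j + 1) - i = M + j + 1 by omega] at this
      exact_mod_cast this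
    have h2 : (((L + (i + j + 1)).choose (j + 1) : ℕ) : ℂ) * (j + 1)
        = (L + (i + j + 1)).choose j * (L + i + 1) := by
      have := Nat.choose_succ_right_eq (L + (i + j + 1)) j
      rw [show L + (i + j + 1) - j = L + i + 1 by omega] at this
      exact_mod_cast this
    have h3 := hc i j rfl
    have ih := ih (by omega)
    rw [show i + j + 1 - i = j + 1 by omega, pow_succ] at ih
    rw [show i + j + 1 - (i + 1) = j by omega]
    have hL : ((L : ℂ) + i + 1) * (i + 1) ≠ 0 := by
      exact_mod_cast (by positivity : (L + i + 1) * (i + 1) ≠ 0)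
    apply mul_right_cancel₀ hL
    rw [eq_neg_of_add_eq_zero_left h3, ih]
    set a := c 0 / _
    linear_combination (-a * (-1) ^ j * (L + (i + j + 1)).choose j * (L + i + 1)) * h1
      + (a * (-1) ^ j * (M + (i + j + 1)).choose i * (M + j + 1)) * h2

/-- `z ^ ℓ` for `ℓ ≥ 0` and `(conj z) ^ |ℓ|` for `ℓ < 0`. -/
def conjPow (ℓ : ℤ) (z : ℂ) : ℂ := z ^ ℓ.toNat * (starRingEnd ℂ z) ^ (-ℓ).toNat

/-- The radial factor of `F k ℓ m`. -/
def radial (k : ℕ) (ℓ m : ℤ) (v : Fin 4 → ℝ) : ℝ :=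
  ∑ i ∈ Finset.range (dd k ℓ m + 1),
    (Nat.choose (m.natAbs + dd k ℓ m) i : ℝ) *
    (Nat.choose (ℓ.natAbs + dd k ℓ m) (dd k ℓ m - i) : ℝ) *
    (v 0 ^ 2 + v 1 ^ 2) ^ i * (-(v 2 ^ 2 + v 3 ^ 2)) ^ (dd k ℓ m - i)

/-- The complex eigenmode of weight `(ℓ, m)` under the torus action. -/
def mode (k : ℕ) (ℓ m : ℤ) (v : Fin 4 → ℝ) : ℂ :=
  radial k ℓ m v * conjPow ℓ (v 0 + v 1 * Complex.I) * conjPow m (v 2 + v 3 * Complex.I)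

lemma F_eq_radial_mul (k : ℕ) (ℓ m : ℤ) (v : Fin 4 → ℝ) :
    F k ℓ m v = radial k ℓ m v * circ ℓ (v 0) (v 1) * circ m (v 2) (v 3) := rfl

lemma radial_neg_left (k : ℕ) (ℓ m : ℤ) : radial k (-ℓ) m = radial k ℓ m := by
  funext v; simp [radial, dd]

lemma radial_neg_right (k : ℕ) (ℓ m : ℤ) : radial k ℓ (-m) = radial k ℓ m := by
  funext v; simp [radial, dd]

lemma conjPow_zero (z : ℂ) : conjPow 0 z = 1 := by simp [conjPow]

lemma conjPow_neg (ℓ : ℤ) (z : ℂ) : conjPow (-ℓ) z = starRingEnd ℂ (conjPow ℓ z) := by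
  simp [conjPow, mul_comm]

lemma conjPow_mul (ℓ : ℤ) (c z : ℂ) : conjPow ℓ (c * z) = conjPow ℓ c * conjPow ℓ z := by
  simp only [conjPow, map_mul, mul_pow]; ring

lemma conjPow_exp (ℓ : ℤ) (θ : ℝ) :
    conjPow ℓ (Complex.exp (θ * Complex.I)) = Complex.exp (ℓ * θ * Complex.I) := by
  simp only [conjPow, ← Complex.exp_conj, ← Complex.exp_nat_mul, ← Complex.exp_add]
  congr 1
  have h : (ℓ : ℂ) = ℓ.toNat - (-ℓ).toNat := by
    exact_mod_cast (Int.toNat_sub_toNat_neg ℓ).symm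
  rw [h]
  simp only [map_mul, Complex.conj_ofReal, Complex.conj_I]
  ring

lemma circ_eq_re {ℓ : ℤ} (h : 0 ≤ ℓ) (a b : ℝ) :
    circ ℓ a b = (conjPow ℓ (a + b * Complex.I)).re := by
  simp [circ, conjPow, h, show ℓ.natAbs = ℓ.toNat by lia, show (-ℓ).toNat = 0 by lia]

lemma circ_neg_eq_im {ℓ : ℤ} (h : 0 < ℓ) (a b : ℝ) :
    circ (-ℓ) a b = (conjPow ℓ (a + b * Complex.I)).im := by
  simp [circ, conjPow, h, show ℓ.natAbs = ℓ.toNat by lia, show (-ℓ).toNat = 0 by lia]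

lemma mode_neg_neg (k : ℕ) (ℓ m : ℤ) (v : Fin 4 → ℝ) :
    mode k (-ℓ) (-m) v = starRingEnd ℂ (mode k ℓ m v) := by
  simp [mode, conjPow_neg, radial_neg_left, radial_neg_right]

lemma mode_Rrot (k : ℕ) (ℓ m : ℤ) (a b : ℝ) (v : Fin 4 → ℝ) :
    mode k ℓ m (Rrot a b v)
      = Complex.exp ((ℓ * a + m * b) * Complex.I) * mode k ℓ m v := by
  have hrot (θ x y : ℝ) : ((x * Real.cos θ - y * Real.sin θ : ℝ) : ℂ)
      + ((x * Real.sin θ + y * Real.cos θ : ℝ) : ℂ) * Complex.I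
      = Complex.exp (θ * Complex.I) * (x + y * Complex.I) := by
    rw [Complex.exp_mul_I]
    push_cast
    linear_combination (-y * Complex.sin θ) * Complex.I_sq
  have hsq (θ x y : ℝ) : (x * Real.cos θ - y * Real.sin θ) ^ 2
      + (x * Real.sin θ + y * Real.cos θ) ^ 2 = x ^ 2 + y ^ 2 := by
    linear_combination (x ^ 2 + y ^ 2) * Real.sin_sq_add_cos_sq θ
  have hr : radial k ℓ m (Rrot a b v) = radial k ℓ m v := by
    simp only [radial, Rrot, Matrix.cons_val, hsq]
  simp only [mode, hr]
  simp only [Rrot, Matrix.cons_val, hrot, conjPow_mul, conjPow_exp, add_mul, Complex.exp_add]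
  ring

/-- The exponent of weight `(ℓ, m)` with `i`, `j` additional conjugate pairs. -/
def weightExponent (ℓ m : ℤ) (i j : ℕ) : Fin 4 →₀ ℕ :=
  Finsupp.equivFunOnFinite.symm ![ℓ.toNat + i, (-ℓ).toNat + i, m.toNat + j, (-m).toNat + j]

lemma sum_coeff_weightExponent (k : ℕ) (ℓ m : ℤ) {Q : MvPolynomial (Fin 4) ℂ}
    (hQ : MvPolynomial.pderiv 0 (MvPolynomial.pderiv 1 Q)
      + MvPolynomial.pderiv 2 (MvPolynomial.pderiv 3 Q) = 0) :
    ∃ a : ℂ, ∀ v, ∑ i ∈ Finset.range (dd k ℓ m + 1),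
      Q.coeff (weightExponent ℓ m i (dd k ℓ m - i)) *
        ∏ t, conjPoint v t ^ weightExponent ℓ m i (dd k ℓ m - i) t = a * mode k ℓ m v := by
  set d := dd k ℓ m with hd
  obtain ⟨a, ha⟩ := exists_eq_mul_choose ℓ.natAbs m.natAbs d
    (fun i => Q.coeff (weightExponent ℓ m i (d - i))) (by
      intro i j hij
      have h := congrArg (MvPolynomial.coeff (weightExponent ℓ m i j)) hQ
      simp only [MvPolynomial.coeff_add, MvPolynomial.coeff_pderiv, MvPolynomial.coeff_zero] at h
      have e1 : weightExponent ℓ m i j + Finsupp.single 0 1 + Finsupp.single 1 1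
          = weightExponent ℓ m (i + 1) (d - (i + 1)) := by
        rw [show d - (i + 1) = j by omega]
        ext t; fin_cases t <;> simp [weightExponent, add_assoc]
      have e2 : weightExponent ℓ m i j + Finsupp.single 2 1 + Finsupp.single 3 1
          = weightExponent ℓ m i (d - i) := by
        rw [show d - i = j + 1 by omega]
        ext t; fin_cases t <;> simp [weightExponent, add_assoc]
      have key (n : ℤ) (r : ℕ) : (n.toNat + r + 1 : ℂ) * ((-n).toNat + r + 1)
          = (n.natAbs + r + 1) * (r + 1) := by
        rcases le_total 0 n with hn | hn
        · simp [show n.natAbs = n.toNat by lia, show (-n).toNat = 0 by lia]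
        · simp [show n.natAbs = (-n).toNat by lia, show n.toNat = 0 by lia, mul_comm]
      rw [e1, e2] at h
      generalize MvPolynomial.coeff (weightExponent ℓ m (i + 1) (d - (i + 1))) Q = A at h ⊢
      generalize MvPolynomial.coeff (weightExponent ℓ m i (d - i)) Q = B at h ⊢
      simp [weightExponent] at h
      rw [← key ℓ i, ← key m j]
      linear_combination h)
  refine ⟨a, fun v => ?_⟩
  rw [mode, radial, ← hd, Complex.ofReal_sum, Finset.sum_mul, Finset.sum_mul, Finset.mul_sum]
  refine Finset.sum_congr rfl fun i hi => ?_
  rw [ha i (by simpa [Nat.lt_succ_iff] using hi)]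
  have hp (x y : ℝ) : ((x : ℂ) + y * Complex.I) * (x - y * Complex.I) = x ^ 2 + y ^ 2 := by
    linear_combination (-(y : ℂ) ^ 2) * Complex.I_sq
  have hc (x y : ℝ) : starRingEnd ℂ ((x : ℂ) + y * Complex.I) = x - y * Complex.I := by
    simp [sub_eq_add_neg]
  simp only [conjPow, hc, Fin.prod_univ_four, conjPoint, weightExponent,
    Finsupp.coe_equivFunOnFinite_symm, Matrix.cons_val, pow_add]
  push_cast
  rw [neg_pow ((v 2 : ℂ) ^ 2 + v 3 ^ 2), ← hp, ← hp, mul_pow, mul_pow]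
  ring

lemma exists_mode_expansion {k : ℕ} {f : (Fin 4 → ℝ) → ℝ} (hf : IsHomogeneousPolyEval k f)
    (hh : IsHarmonic f) :
    ∃ (W : Finset (ℤ × ℤ)) (c : ℤ × ℤ → ℂ),
      (∀ w ∈ W, w.1.natAbs + w.2.natAbs ≤ k ∧ Int.ModEq 2 (w.1 + w.2) k) ∧
      ∀ v, (f v : ℂ) = ∑ w ∈ W, c w * mode k w.1 w.2 v := by
  obtain ⟨P, hP, hPf⟩ := hf
  set Q := MvPolynomial.aeval conjCoords P with hQ
  have hlap := pderiv_aeval_conjCoords (laplacian_eq_zero_of_isHarmonic hPf hh)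
  have hdeg : ∀ s ∈ Q.support, s 0 + s 1 + s 2 + s 3 = k := by
    intro s hs
    by_contra hne
    refine MvPolynomial.mem_support_iff.1 hs
      ((isHomogeneous_aeval_conjCoords hP).coeff_eq_zero ?_)
    rwa [Finsupp.degree_eq_sum, Fin.sum_univ_four]
  choose a ha using fun w : ℤ × ℤ => sum_coeff_weightExponent k w.1 w.2 hlap
  let wt (s : Fin 4 →₀ ℕ) : ℤ × ℤ := ((s 0 : ℤ) - s 1, (s 2 : ℤ) - s 3)
  have hW : ∀ w ∈ Q.support.image wt,
      w.1.natAbs + w.2.natAbs ≤ k ∧ Int.ModEq 2 (w.1 + w.2) k := by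
    intro w hw
    obtain ⟨s, hs, rfl⟩ := Finset.mem_image.1 hw
    have := hdeg s hs
    refine ⟨?_, ?_⟩
    · simp only [wt]; omega
    · simp only [wt, Int.ModEq]; omega
  refine ⟨Q.support.image wt, a, hW, fun v => ?_⟩
  rw [← hPf, ← eval_conjPoint_aeval, ← hQ, MvPolynomial.eval_eq',
    ← Finset.sum_fiberwise_of_maps_to (fun s hs => Finset.mem_image_of_mem wt hs)]
  refine Finset.sum_congr rfl fun w hw => ?_
  rw [← ha w v]
  obtain ⟨hw1, hw2⟩ := hW w hw
  have hdd : w.1.natAbs + w.2.natAbs + 2 * dd k w.1 w.2 = k := by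
    simp only [Int.ModEq, dd] at hw2 ⊢; omega
  have hinj : Set.InjOn (fun i => weightExponent w.1 w.2 i (dd k w.1 w.2 - i))
      (Finset.range (dd k w.1 w.2 + 1)) := by
    intro i _ j _ hij
    simpa [weightExponent] using DFunLike.congr_fun hij 0
  rw [← Finset.sum_image (f := fun s => Q.coeff s * ∏ t, conjPoint v t ^ s t) hinj]
  refine Finset.sum_subset ?_ ?_
  · intro s hs
    obtain ⟨hmem, rfl⟩ := Finset.mem_filter.1 hs
    have := hdeg s hmem
    refine Finset.mem_image.2 ⟨min (s 0) (s 1), ?_, ?_⟩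
    · simp only [wt] at hdd; simp only [wt, Finset.mem_range]; omega
    · simp only [wt] at hdd ⊢
      ext t; fin_cases t <;> simp [weightExponent] <;> omega
  · intro s hs hs'
    obtain ⟨i, hi, rfl⟩ := Finset.mem_image.1 hs
    rw [MvPolynomial.notMem_support_iff.1, zero_mul]
    refine fun h => hs' (Finset.mem_filter.2 ⟨h, Prod.ext ?_ ?_⟩) <;>
    simp [wt, weightExponent]

/-- The eigenmodes listed for the lens space `L(p,q)` in degree `k`. -/
def lensModes (p q : ℤ) (k : ℕ) : Set ((Fin 4 → ℝ) → ℝ) :=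
  {h : (Fin 4 → ℝ) → ℝ |
      (Int.ModEq 2 0 k ∧ h = F k 0 0) ∨
      (∃ ℓ : ℤ, 0 < ℓ ∧ ℓ.natAbs ≤ k ∧ Int.ModEq 2 ℓ k ∧
        Int.ModEq p ℓ 0 ∧ (h = F k ℓ 0 ∨ h = F k (-ℓ) 0)) ∨
      (∃ m : ℤ, 0 < m ∧ m.natAbs ≤ k ∧ Int.ModEq 2 m k ∧
        Int.ModEq p (q * m) 0 ∧ (h = F k 0 m ∨ h = F k 0 (-m))) ∨
      (∃ ℓ m : ℤ, 0 < ℓ ∧ 0 < m ∧ ℓ.natAbs + m.natAbs ≤ k ∧ Int.ModEq 2 (ℓ + m) k ∧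
        Int.ModEq p ℓ (q * m) ∧
        (h = F k ℓ m + F k (-ℓ) (-m) ∨ h = F k (-ℓ) m - F k ℓ (-m))) ∨
      (∃ ℓ m : ℤ, 0 < ℓ ∧ 0 < m ∧ ℓ.natAbs + m.natAbs ≤ k ∧ Int.ModEq 2 (ℓ + m) k ∧
        Int.ModEq p ℓ (-(q * m)) ∧
        (h = F k ℓ m - F k (-ℓ) (-m) ∨ h = F k (-ℓ) m + F k ℓ (-m)))}

lemma mode_re_of_pos (k : ℕ) {ℓ m : ℤ} (hℓ : 0 < ℓ) (hm : 0 < m) :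
    (fun v => (mode k ℓ m v).re) = F k ℓ m - F k (-ℓ) (-m) := by
  funext v
  simp only [Pi.sub_apply, F_eq_radial_mul, radial_neg_left, radial_neg_right, mode,
    circ_eq_re hℓ.le, circ_eq_re hm.le, circ_neg_eq_im hℓ, circ_neg_eq_im hm, Complex.mul_re,
    Complex.mul_im, Complex.ofReal_re, Complex.ofReal_im]
  ring

lemma mode_im_of_pos (k : ℕ) {ℓ m : ℤ} (hℓ : 0 < ℓ) (hm : 0 < m) :
    (fun v => (mode k ℓ m v).im) = F k (-ℓ) m + F k ℓ (-m) := by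
  funext v
  simp only [Pi.add_apply, F_eq_radial_mul, radial_neg_left, radial_neg_right, mode,
    circ_eq_re hℓ.le, circ_eq_re hm.le, circ_neg_eq_im hℓ, circ_neg_eq_im hm, Complex.mul_re,
    Complex.mul_im, Complex.ofReal_re, Complex.ofReal_im]
  ring

lemma mode_neg_right_re (k : ℕ) {ℓ m : ℤ} (hℓ : 0 < ℓ) (hm : 0 < m) :
    (fun v => (mode k ℓ (-m) v).re) = F k ℓ m + F k (-ℓ) (-m) := by
  funext v
  simp only [Pi.add_apply, F_eq_radial_mul, radial_neg_left, radial_neg_right, mode,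
    circ_eq_re hℓ.le, circ_eq_re hm.le, circ_neg_eq_im hℓ, circ_neg_eq_im hm, Complex.mul_re,
    Complex.mul_im, Complex.ofReal_re, Complex.ofReal_im, conjPow_neg m, Complex.conj_re,
    Complex.conj_im]
  ring

lemma mode_neg_right_im (k : ℕ) {ℓ m : ℤ} (hℓ : 0 < ℓ) (hm : 0 < m) :
    (fun v => (mode k ℓ (-m) v).im) = F k (-ℓ) m - F k ℓ (-m) := by
  funext v
  simp only [Pi.sub_apply, F_eq_radial_mul, radial_neg_left, radial_neg_right, mode,
    circ_eq_re hℓ.le, circ_eq_re hm.le, circ_neg_eq_im hℓ, circ_neg_eq_im hm, Complex.mul_re,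
    Complex.mul_im, Complex.ofReal_re, Complex.ofReal_im, conjPow_neg m, Complex.conj_re,
    Complex.conj_im]
  ring

lemma mode_zero_right_re (k : ℕ) {ℓ : ℤ} (hℓ : 0 ≤ ℓ) :
    (fun v => (mode k ℓ 0 v).re) = F k ℓ 0 := by
  funext v
  simp [F_eq_radial_mul, mode, circ_eq_re hℓ, circ_eq_re le_rfl, conjPow_zero]

lemma mode_zero_right_im (k : ℕ) {ℓ : ℤ} (hℓ : 0 < ℓ) :
    (fun v => (mode k ℓ 0 v).im) = F k (-ℓ) 0 := by
  funext v
  simp [F_eq_radial_mul, mode, circ_neg_eq_im hℓ, circ_eq_re le_rfl, conjPow_zero,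
    radial_neg_left]

lemma mode_zero_left_re (k : ℕ) {m : ℤ} (hm : 0 ≤ m) :
    (fun v => (mode k 0 m v).re) = F k 0 m := by
  funext v
  simp [F_eq_radial_mul, mode, circ_eq_re hm, circ_eq_re le_rfl, conjPow_zero]

lemma mode_zero_left_im (k : ℕ) {m : ℤ} (hm : 0 < m) :
    (fun v => (mode k 0 m v).im) = F k 0 (-m) := by
  funext v
  simp [F_eq_radial_mul, mode, circ_neg_eq_im hm, circ_eq_re le_rfl, conjPow_zero,
    radial_neg_right]

lemma exists_mode_of_mem_lensModes {p q : ℤ} {k : ℕ} {h : (Fin 4 → ℝ) → ℝ}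
    (hmem : h ∈ lensModes p q k) :
    ∃ ℓ m : ℤ, p ∣ ℓ + q * m ∧
      (h = (fun v => (mode k ℓ m v).re) ∨ h = fun v => (mode k ℓ m v).im) := by
  rcases hmem with ⟨-, rfl⟩ | ⟨ℓ, hℓ, -, -, hp, hh⟩ | ⟨m, hm, -, -, hp, hh⟩ |
    ⟨ℓ, m, hℓ, hm, -, -, hp, hh⟩ | ⟨ℓ, m, hℓ, hm, -, -, hp, hh⟩
  · exact ⟨0, 0, by simp, .inl (mode_zero_left_re k le_rfl).symm⟩
  · refine ⟨ℓ, 0, by simpa using Int.modEq_zero_iff_dvd.1 hp, ?_⟩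
    rwa [mode_zero_right_re k hℓ.le, mode_zero_right_im k hℓ]
  · refine ⟨0, m, by simpa using Int.modEq_zero_iff_dvd.1 hp, ?_⟩
    rwa [mode_zero_left_re k hm.le, mode_zero_left_im k hm]
  · refine ⟨ℓ, -m, by simpa [sub_eq_add_neg] using hp.symm.dvd, ?_⟩
    rwa [mode_neg_right_re k hℓ hm, mode_neg_right_im k hℓ hm]
  · refine ⟨ℓ, m, by simpa using hp.symm.dvd, ?_⟩
    rwa [mode_re_of_pos k hℓ hm, mode_im_of_pos k hℓ hm]

lemma mode_re_im_mem_span_of_pos_or {p q : ℤ} {k : ℕ} {ℓ m : ℤ} (hpos : 0 < ℓ ∨ ℓ = 0 ∧ 0 ≤ m)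
    (hk : ℓ.natAbs + m.natAbs ≤ k) (hpar : Int.ModEq 2 (ℓ + m) k) (hp : p ∣ ℓ + q * m) :
    (fun v => (mode k ℓ m v).re) ∈ Submodule.span ℝ (lensModes p q k) ∧
    (fun v => (mode k ℓ m v).im) ∈ Submodule.span ℝ (lensModes p q k) := by
  rcases hpos with hℓ | ⟨rfl, hm⟩
  · rcases lt_trichotomy m 0 with hm | rfl | hm
    · obtain ⟨n, rfl⟩ : ∃ n, m = -n := ⟨-m, by simp⟩
      have hn : 0 < n := by simpa using hm
      have hmod : Int.ModEq p ℓ (q * n) :=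
        (Int.modEq_iff_dvd.2 (by simpa [sub_eq_add_neg] using hp)).symm
      have hpar' : Int.ModEq 2 (ℓ + n) k := by simp only [Int.ModEq] at hpar ⊢; omega
      rw [Int.natAbs_neg] at hk
      rw [mode_neg_right_re k hℓ hn, mode_neg_right_im k hℓ hn]
      exact ⟨Submodule.subset_span
          (.inr (.inr (.inr (.inl ⟨ℓ, n, hℓ, hn, hk, hpar', hmod, .inl rfl⟩)))),
        Submodule.subset_span
          (.inr (.inr (.inr (.inl ⟨ℓ, n, hℓ, hn, hk, hpar', hmod, .inr rfl⟩))))⟩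
    · rw [mode_zero_right_re k hℓ.le, mode_zero_right_im k hℓ]
      have hmod : Int.ModEq p ℓ 0 := Int.modEq_zero_iff_dvd.2 (by simpa using hp)
      simp only [Int.natAbs_zero, add_zero] at hk hpar
      exact ⟨Submodule.subset_span (.inr (.inl ⟨ℓ, hℓ, hk, hpar, hmod, .inl rfl⟩)),
        Submodule.subset_span (.inr (.inl ⟨ℓ, hℓ, hk, hpar, hmod, .inr rfl⟩))⟩
    · have hmod : Int.ModEq p ℓ (-(q * m)) :=
        (Int.modEq_iff_dvd.2 (by simpa using hp)).symm
      rw [mode_re_of_pos k hℓ hm, mode_im_of_pos k hℓ hm]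
      exact ⟨Submodule.subset_span
          (.inr (.inr (.inr (.inr ⟨ℓ, m, hℓ, hm, hk, hpar, hmod, .inl rfl⟩)))),
        Submodule.subset_span
          (.inr (.inr (.inr (.inr ⟨ℓ, m, hℓ, hm, hk, hpar, hmod, .inr rfl⟩))))⟩
  · simp only [Int.natAbs_zero, zero_add] at hk hpar hp
    rcases hm.eq_or_lt with rfl | hm
    · refine ⟨?_, ?_⟩
      · rw [mode_zero_right_re k le_rfl]
        exact Submodule.subset_span (.inl ⟨hpar, rfl⟩)
      · simp only [mode, conjPow_zero, mul_one, Complex.ofReal_im]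
        exact Submodule.zero_mem _
    · rw [mode_zero_left_re k hm.le, mode_zero_left_im k hm]
      have hmod : Int.ModEq p (q * m) 0 := Int.modEq_zero_iff_dvd.2 hp
      exact ⟨Submodule.subset_span (.inr (.inr (.inl ⟨m, hm, hk, hpar, hmod, .inl rfl⟩))),
        Submodule.subset_span (.inr (.inr (.inl ⟨m, hm, hk, hpar, hmod, .inr rfl⟩)))⟩

lemma mode_re_im_mem_span {p q : ℤ} {k : ℕ} {ℓ m : ℤ}
    (hk : ℓ.natAbs + m.natAbs ≤ k) (hpar : Int.ModEq 2 (ℓ + m) k) (hp : p ∣ ℓ + q * m) :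
    (fun v => (mode k ℓ m v).re) ∈ Submodule.span ℝ (lensModes p q k) ∧
    (fun v => (mode k ℓ m v).im) ∈ Submodule.span ℝ (lensModes p q k) := by
  by_cases hpos : 0 < ℓ ∨ ℓ = 0 ∧ 0 ≤ m
  · exact mode_re_im_mem_span_of_pos_or hpos hk hpar hp
  · obtain ⟨hre, him⟩ := mode_re_im_mem_span_of_pos_or (p := p) (q := q) (k := k)
      (ℓ := -ℓ) (m := -m) (by omega) (by simpa using hk)
      (by simp only [Int.ModEq] at hpar ⊢; omega)
      (by rw [mul_neg, ← neg_add]; exact dvd_neg.2 hp)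
    simp only [mode_neg_neg, Complex.conj_re, Complex.conj_im] at hre him
    exact ⟨hre, (Submodule.neg_mem_iff _).1 him⟩

lemma re_mul_mode_mem_span {p q : ℤ} {k : ℕ} {ℓ m : ℤ} (c : ℂ)
    (hk : ℓ.natAbs + m.natAbs ≤ k) (hpar : Int.ModEq 2 (ℓ + m) k) (hp : p ∣ ℓ + q * m) :
    (fun v => (c * mode k ℓ m v).re) ∈ Submodule.span ℝ (lensModes p q k) := by
  obtain ⟨hre, him⟩ := mode_re_im_mem_span hk hpar hp
  exact Submodule.sub_mem _ (Submodule.smul_mem _ c.re hre) (Submodule.smul_mem _ c.im him)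

/-- The eigenvalue of the lens rotation on the mode of weight `(ℓ, m)`. -/
def lensEigenvalue (p q ℓ m : ℤ) : ℂ :=
  Complex.exp (2 * Real.pi * Complex.I * ((ℓ + q * m : ℤ) / p))

lemma mode_lensRotation (p q : ℤ) (k : ℕ) (ℓ m : ℤ) (v : Fin 4 → ℝ) :
    mode k ℓ m (Rrot (2 * Real.pi / p) (2 * Real.pi * q / p) v)
      = lensEigenvalue p q ℓ m * mode k ℓ m v := by
  rw [mode_Rrot, lensEigenvalue]
  push_cast
  ring_nf

lemma lensEigenvalue_eq_one_iff {p q ℓ m : ℤ} (hp : p ≠ 0) :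
    lensEigenvalue p q ℓ m = 1 ↔ p ∣ ℓ + q * m := by
  have hp' : (p : ℂ) ≠ 0 := by exact_mod_cast hp
  rw [lensEigenvalue, Complex.exp_eq_one_iff]
  refine ⟨fun ⟨n, hn⟩ => ⟨n, ?_⟩, fun ⟨n, hn⟩ => ⟨n, ?_⟩⟩
  · rw [mul_comm (n : ℂ), mul_right_inj' Complex.two_pi_I_ne_zero, div_eq_iff hp'] at hn
    rw [mul_comm p n]
    exact_mod_cast hn
  · rw [hn]
    push_cast
    field_simp

lemma sum_range_lensEigenvalue_pow {p : ℕ} (q ℓ m : ℤ) (hp : p ≠ 0) :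
    ∑ j ∈ Finset.range p, lensEigenvalue p q ℓ m ^ j
      = if (p : ℤ) ∣ ℓ + q * m then (p : ℂ) else 0 := by
  have hp' : (p : ℂ) ≠ 0 := by exact_mod_cast hp
  have hiff := lensEigenvalue_eq_one_iff (q := q) (ℓ := ℓ) (m := m) (Int.natCast_ne_zero.2 hp)
  split_ifs with h
  · simp [hiff.2 h]
  · rw [geom_sum_eq (fun h1 => h (hiff.1 h1))]
    have : lensEigenvalue p q ℓ m ^ p = 1 := by
      rw [lensEigenvalue, ← Complex.exp_nat_mul, Complex.exp_eq_one_iff]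
      exact ⟨ℓ + q * m, by push_cast; field_simp⟩
    simp [this]

lemma mem_span_lensModes_of_invariant {p : ℕ} {q : ℤ} (hp : p ≠ 0) {k : ℕ}
    {f : (Fin 4 → ℝ) → ℝ} (hf : IsHomogeneousPolyEval k f) (hh : IsHarmonic f)
    (hinv : f ∘ Rrot (2 * Real.pi / (p : ℤ)) (2 * Real.pi * q / (p : ℤ)) = f) :
    f ∈ Submodule.span ℝ (lensModes p q k) := by
  obtain ⟨W, c, hW, hfc⟩ := exists_mode_expansion hf hh
  set g := Rrot (2 * Real.pi / (p : ℤ)) (2 * Real.pi * q / (p : ℤ)) with hg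
  have hiter (j : ℕ) (v : Fin 4 → ℝ) : f (g^[j] v) = f v := by
    induction j generalizing v with
    | zero => rfl
    | succ j ih => rw [Function.iterate_succ_apply, ih]; exact congrFun hinv v
  have hmode (j : ℕ) (ℓ m : ℤ) (v : Fin 4 → ℝ) :
      mode k ℓ m (g^[j] v) = lensEigenvalue p q ℓ m ^ j * mode k ℓ m v := by
    induction j generalizing v with
    | zero => simp
    | succ j ih => rw [Function.iterate_succ_apply, ih, hg, mode_lensRotation]; ring
  have hp' : (p : ℂ) ≠ 0 := by exact_mod_cast hp
  have hsum (v : Fin 4 → ℝ) : (f v : ℂ)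
      = ∑ w ∈ W with (p : ℤ) ∣ w.1 + q * w.2, c w * mode k w.1 w.2 v := by
    apply mul_left_cancel₀ hp'
    calc (p : ℂ) * f v = ∑ j ∈ Finset.range p, (f (g^[j] v) : ℂ) := by simp [hiter]
      _ = ∑ w ∈ W, (∑ j ∈ Finset.range p, lensEigenvalue p q w.1 w.2 ^ j)
            * (c w * mode k w.1 w.2 v) := by
        simp only [hfc, hmode, Finset.sum_mul]
        rw [Finset.sum_comm]
        exact Finset.sum_congr rfl fun w _ => Finset.sum_congr rfl fun j _ => by ring
      _ = _ := by
        simp only [sum_range_lensEigenvalue_pow q _ _ hp, Finset.sum_filter, Finset.mul_sum]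
        exact Finset.sum_congr rfl fun w _ => by split_ifs <;> simp
  have hre : f = ∑ w ∈ W with (p : ℤ) ∣ w.1 + q * w.2,
      fun v => (c w * mode k w.1 w.2 v).re := by
    funext v
    rw [Finset.sum_apply, ← Complex.re_sum, ← hsum, Complex.ofReal_re]
  rw [hre]
  refine Submodule.sum_mem _ fun w hw => ?_
  obtain ⟨hw, hdvd⟩ := Finset.mem_filter.1 hw
  exact re_mul_mode_mem_span _ (hW w hw).1 (hW w hw).2 hdvd

lemma invariant_of_mem_span_lensModes {p q : ℤ} (hp : p ≠ 0) {k : ℕ} {f : (Fin 4 → ℝ) → ℝ}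
    (hf : f ∈ Submodule.span ℝ (lensModes p q k)) :
    f ∘ Rrot (2 * Real.pi / p) (2 * Real.pi * q / p) = f := by
  induction hf using Submodule.span_induction with
  | mem h hmem =>
    obtain ⟨ℓ, m, hdvd, rfl | rfl⟩ := exists_mode_of_mem_lensModes hmem <;>
    · funext v
      simp [mode_lensRotation, (lensEigenvalue_eq_one_iff hp).2 hdvd]
  | zero => rfl
  | add a b _ _ ha hb => rw [Pi.add_comp, ha, hb]
  | smul r a _ ha => rw [Pi.smul_comp, ha]

/-- Theorem 2: a homogeneous harmonic polynomial function of
degree `k` is invariant under the generator `R(2π/p, 2πq/p)` of the lens space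
`L(p,q)` iff it is a real linear combination of the listed eigenmodes. -/
theorem stmt_12 (p q : ℤ) (hp : 1 ≤ p) (k : ℕ) (f : (Fin 4 → ℝ) → ℝ)
    (hf : IsHomogeneousPolyEval k f) (hh : IsHarmonic f) :
    f ∘ Rrot (2 * Real.pi / p) (2 * Real.pi * q / p) = f ↔
    f ∈ Submodule.span ℝ {h : (Fin 4 → ℝ) → ℝ |
      (Int.ModEq 2 0 k ∧ h = F k 0 0) ∨
      (∃ ℓ : ℤ, 0 < ℓ ∧ ℓ.natAbs ≤ k ∧ Int.ModEq 2 ℓ k ∧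
        Int.ModEq p ℓ 0 ∧ (h = F k ℓ 0 ∨ h = F k (-ℓ) 0)) ∨
      (∃ m : ℤ, 0 < m ∧ m.natAbs ≤ k ∧ Int.ModEq 2 m k ∧
        Int.ModEq p (q * m) 0 ∧ (h = F k 0 m ∨ h = F k 0 (-m))) ∨
      (∃ ℓ m : ℤ, 0 < ℓ ∧ 0 < m ∧ ℓ.natAbs + m.natAbs ≤ k ∧ Int.ModEq 2 (ℓ + m) k ∧
        Int.ModEq p ℓ (q * m) ∧
        (h = F k ℓ m + F k (-ℓ) (-m) ∨ h = F k (-ℓ) m - F k ℓ (-m))) ∨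
      (∃ ℓ m : ℤ, 0 < ℓ ∧ 0 < m ∧ ℓ.natAbs + m.natAbs ≤ k ∧ Int.ModEq 2 (ℓ + m) k ∧
        Int.ModEq p ℓ (-(q * m)) ∧
        (h = F k ℓ m - F k (-ℓ) (-m) ∨ h = F k (-ℓ) m + F k ℓ (-m)))} := by
  lift p to ℕ using by omega
  have hp0 : p ≠ 0 := by omega
  exact ⟨mem_span_lensModes_of_invariant hp0 hf hh,
    invariant_of_mem_span_lensModes (Int.natCast_ne_zero.2 hp0)⟩

end
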